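/- For every rooted tree T, 𝒫(T;2,1) equals the number of antichains of T, where the empty set counts as an antichain. -/

import Mathlib

/-- A rooted tree: a root together with a list of branches. -/
inductive RTree : Type
  | node : List RTree → RTree

namespace RTree

/-- Number of vertices of a rooted tree. -/
def size : RTree → ℕ
  | node ts => 1 + (ts.attach.map fun t => t.1.size).sum
decreasing_by
  have := List.sizeOf_lt_of_mem t.2
  simp only [node.sizeOf_spec]
  omega

/-- The Tutte-like polynomial `𝒫(T; x, y)`, evaluated at integers `x, y`. -/
def pol : RTree → ℤ → ℤ → ℤ
  | node ts, x, y =>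
    if ts.isEmpty then x
    else (ts.attach.map fun t => pol t.1 x y).prod + y ^ ((node ts).size - 1)
decreasing_by
  have := List.sizeOf_lt_of_mem t.2
  simp only [node.sizeOf_spec]
  omega

/-- The subtree of `T` rooted at the vertex reached by following the path `p`
of child indices from the root, if such a vertex exists. -/
def subtree? : RTree → List ℕ → Option RTree
  | t, [] => some t
  | node ts, i :: p => (ts[i]?).bind fun t => subtree? t p

/-- `p` is a vertex of `T` (vertices are identified with the paths of child
indices leading to them from the root). -/
def IsVertex (T : RTree) (p : List ℕ) : Prop := (T.subtree? p).isSome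

/-- `p` is a leaf of `T`: a vertex with no children. -/
def IsLeaf (T : RTree) (p : List ℕ) : Prop := T.subtree? p = some (node [])

/-- `A` is an antichain of `T`: a set of vertices no two of which lie on a common
path from the root, i.e. no element of `A` is an ancestor (= path-prefix) of
another. -/
def IsAntichainIn (T : RTree) (A : Finset (List ℕ)) : Prop :=
  (∀ p ∈ A, T.IsVertex p) ∧ ∀ p ∈ A, ∀ q ∈ A, p ≠ q → ¬ p <+: q

/-- `A` is a maximal antichain of `T`: an antichain that is not a proper subset of
another antichain. -/
def IsMaxAntichainIn (T : RTree) (A : Finset (List ℕ)) : Prop :=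
  T.IsAntichainIn A ∧ ∀ B : Finset (List ℕ), T.IsAntichainIn B → A ⊆ B → A = B

/-- `ℓ(A)`: the number of leaves of `T` contained in `A`. -/
noncomputable def leafCount (T : RTree) (A : Finset (List ℕ)) : ℕ :=
  {p ∈ (A : Set (List ℕ)) | T.IsLeaf p}.ncard

/-- The number of vertices of the subtree `T_p` of `T` rooted at the vertex `p`
(and `0` if `p` is not a vertex). -/
def subSize (T : RTree) (p : List ℕ) : ℕ := ((T.subtree? p).map size).getD 0

/-- `s(A) = ∑_{a ∈ A} (|T_a| − 1)`: the number of vertices strictly below `A`. -/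
def succCount (T : RTree) (A : Finset (List ℕ)) : ℕ := ∑ p ∈ A, (T.subSize p - 1)

end RTree

namespace RTree

theorem induction_on_branches {P : RTree → Prop}
    (h : ∀ ts : List RTree, (∀ t ∈ ts, P t) → P (node ts)) : ∀ T, P T
  | node ts => h ts fun t _ => induction_on_branches h t
decreasing_by
  have := List.sizeOf_lt_of_mem ‹t ∈ ts›
  simp only [node.sizeOf_spec]
  omega

theorem pol_node_two_one (ts : List RTree) :
    (node ts).pol 2 1 = (ts.map fun t => t.pol 2 1).prod + 1 := by
  rw [pol]
  cases ts <;> simp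

theorem isVertex_nil (T : RTree) : T.IsVertex [] := by
  cases T; simp [IsVertex, subtree?]

theorem isVertex_node_cons {ts : List RTree} {i : ℕ} {p : List ℕ} :
    (node ts).IsVertex (i :: p) ↔ ∃ h : i < ts.length, ts[i].IsVertex p := by
  by_cases h : i < ts.length <;> simp [IsVertex, subtree?, h]

theorem isAntichainIn_singleton_nil (T : RTree) : T.IsAntichainIn {[]} := by
  simp [IsAntichainIn, isVertex_nil]

theorem IsAntichainIn.eq_singleton_nil {T : RTree} {A : Finset (List ℕ)}
    (hA : T.IsAntichainIn A) (h : [] ∈ A) : A = {[]} := by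
  refine Finset.eq_singleton_iff_unique_mem.2 ⟨h, fun p hp => ?_⟩
  by_contra hne
  exact hA.2 [] h p hp (Ne.symm hne) List.nil_prefix

/-- An antichain avoiding the root is a choice of an antichain in each branch. -/
noncomputable def antichainEquivPi (ts : List RTree) :
    {A : Finset (List ℕ) // (node ts).IsAntichainIn A ∧ [] ∉ A} ≃
      ∀ i : Fin ts.length, {A : Finset (List ℕ) // ts[i.1].IsAntichainIn A} where
  toFun A i := ⟨A.1.preimage (List.cons i.1) List.cons_injective.injOn, by
    obtain ⟨A, ⟨hv, hA⟩, -⟩ := A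
    refine ⟨fun p hp => ?_, fun p hp q hq hne hpq => ?_⟩
    · exact (isVertex_node_cons.1 (hv _ (Finset.mem_preimage.1 hp))).2
    · exact hA _ (Finset.mem_preimage.1 hp) _ (Finset.mem_preimage.1 hq) (by simpa using hne)
        (by simpa using hpq)⟩
  invFun f := ⟨Finset.univ.biUnion fun i => (f i).1.image (List.cons i.1), by
    simp only [IsAntichainIn, Finset.mem_biUnion, Finset.mem_univ, true_and, Finset.mem_image]
    refine ⟨⟨?_, ?_⟩, by simp⟩
    · rintro _ ⟨i, p, hp, rfl⟩
      exact isVertex_node_cons.2 ⟨i.2, (f i).2.1 p hp⟩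
    · rintro _ ⟨i, p, hp, rfl⟩ _ ⟨j, q, hq, rfl⟩ hne hpq
      obtain ⟨hij, htail⟩ := List.cons_prefix_cons.1 hpq
      obtain rfl := Fin.ext hij
      exact (f i).2.2 p hp q hq (by simpa using hne) htail⟩
  left_inv A := by
    obtain ⟨A, ⟨hv, hA⟩, hnil⟩ := A
    ext p
    simp only [Finset.mem_biUnion, Finset.mem_univ, true_and, Finset.mem_image,
      Finset.mem_preimage]
    constructor
    · rintro ⟨i, p, hp, rfl⟩
      exact hp
    · intro hp
      cases p with
      | nil => exact absurd hp hnil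
      | cons i p => exact ⟨⟨i, (isVertex_node_cons.1 (hv _ hp)).1⟩, p, hp, rfl⟩
  right_inv f := by
    funext i
    ext p
    simp only [Finset.mem_biUnion, Finset.mem_univ, true_and, Finset.mem_image,
      Finset.mem_preimage, List.cons.injEq]
    constructor
    · rintro ⟨j, q, hq, hij, rfl⟩
      obtain rfl := Fin.ext hij
      exact hq
    · exact fun hp => ⟨i, p, hp, rfl, rfl⟩

theorem setOf_isAntichainIn_eq_insert (T : RTree) :
    {A | T.IsAntichainIn A} = insert {[]} {A | T.IsAntichainIn A ∧ [] ∉ A} := by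
  ext A
  simp only [Set.mem_insert_iff, Set.mem_ofPred_eq]
  constructor
  · intro hA
    by_cases h : [] ∈ A
    · exact .inl (hA.eq_singleton_nil h)
    · exact .inr ⟨hA, h⟩
  · rintro (rfl | h)
    · exact T.isAntichainIn_singleton_nil
    · exact h.1

theorem finite_setOf_isAntichainIn (T : RTree) : {A | T.IsAntichainIn A}.Finite := by
  induction T using induction_on_branches with
  | h ts ih =>
    have (i : Fin ts.length) : Finite {A // ts[i.1].IsAntichainIn A} := ih _ (List.getElem_mem _)
    rw [setOf_isAntichainIn_eq_insert]
    exact Set.Finite.insert _ (Finite.of_equiv _ (antichainEquivPi ts).symm)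

theorem ncard_setOf_isAntichainIn_node (ts : List RTree) :
    {A | (node ts).IsAntichainIn A}.ncard =
      (ts.map fun t => {A | t.IsAntichainIn A}.ncard).prod + 1 := by
  have hfin : {A | (node ts).IsAntichainIn A ∧ [] ∉ A}.Finite :=
    (finite_setOf_isAntichainIn _).subset fun _ h => h.1
  rw [setOf_isAntichainIn_eq_insert, Set.ncard_insert_of_notMem (by simp) hfin,
    ← Fin.prod_univ_fun_getElem]
  exact congrArg (· + 1) ((Nat.card_congr (antichainEquivPi ts)).trans Nat.card_pi)

end RTree

/-- For every rooted tree `T`, `𝒫(T;2,1)` equals the number of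
antichains of `T` (the empty set counting as an antichain). -/
theorem pol_two_one (T : RTree) :
    T.pol 2 1 = {A : Finset (List ℕ) | T.IsAntichainIn A}.ncard := by
  induction T using RTree.induction_on_branches with
  | h ts ih =>
    rw [RTree.pol_node_two_one, RTree.ncard_setOf_isAntichainIn_node, List.map_congr_left ih]
    simp [Nat.cast_list_prod, Function.comp_def]
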